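/- For Re(a) > 0, Re(ν) > -1, and y > 0, the integral ∫₀^∞ x^{ν+1} e^{-a x} J_ν(x y) dx equals π^{-1/2} 2^{ν+1} Γ(ν + 3/2) a y^ν / (a² + y²)^{ν + 3/2}, where J_ν is the Bessel function of the first kind of order ν. -/

import Mathlib

open Real MeasureTheory
noncomputable section

/-- Bessel function of the first kind of order ν (series definition). -/
def besselJ (ν : ℂ) (x : ℝ) : ℂ :=
  ∑' m : ℕ, ((-1)^m / (m.factorial * Complex.Gamma ((m:ℂ) + ν + 1))) * ((x : ℂ)/2) ^ (2*(m:ℂ) + ν)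

/-- The coefficients of the Bessel–Clifford series. -/
def besselCoeff (ν : ℂ) (m : ℕ) : ℂ := (-1) ^ m / (m.factorial * Complex.Gamma (m + ν + 1))

/-- The Bessel–Clifford function `w ↦ ∑ (-w)^m / (m! Γ(m + ν + 1))` on the real line, so that
`J_ν(x) = (x/2)^ν C_ν(x²/4)` for `x > 0`. -/
def besselClifford (ν : ℂ) (w : ℝ) : ℂ := ∑' m : ℕ, besselCoeff ν m * (w : ℂ) ^ m

lemma natCast_add_add_one_ne_zero {ν : ℂ} (hν : -1 < ν.re) (m : ℕ) : (m : ℂ) + ν + 1 ≠ 0 := by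
  intro h
  have := congrArg Complex.re h
  simp only [Complex.add_re, Complex.natCast_re, Complex.one_re, Complex.zero_re] at this
  have : (0 : ℝ) ≤ m := m.cast_nonneg
  linarith

lemma besselCoeff_succ {ν : ℂ} (hν : -1 < ν.re) (m : ℕ) :
    besselCoeff ν (m + 1) = -besselCoeff ν m / ((m + 1) * (m + ν + 1)) := by
  have h := natCast_add_add_one_ne_zero hν m
  have hG : Complex.Gamma ((m + 1 : ℕ) + ν + 1) = (m + ν + 1) * Complex.Gamma (m + ν + 1) := by
    rw [← Complex.Gamma_add_one _ h]
    push_cast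
    ring_nf
  rw [besselCoeff, besselCoeff, hG, Nat.factorial_succ, pow_succ]
  push_cast
  rw [← neg_div, div_div]
  congr 1 <;> ring

lemma succ_mul_besselCoeff_succ (ν : ℂ) (m : ℕ) :
    ((m : ℂ) + 1) * besselCoeff ν (m + 1) = -besselCoeff (ν + 1) m := by
  have h : (m : ℂ) + 1 ≠ 0 := by exact_mod_cast m.succ_ne_zero
  rw [besselCoeff, besselCoeff, Nat.factorial_succ, pow_succ]
  push_cast
  rw [show (m : ℂ) + 1 + ν + 1 = m + (ν + 1) + 1 by ring, mul_div_assoc', mul_assoc (m + 1 : ℂ),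
    mul_div_mul_left _ _ h]
  ring

lemma besselCoeff_eq_mul_besselCoeff_add_one {ν : ℂ} (hν : -1 < ν.re) (m : ℕ) :
    besselCoeff ν m = (m + ν + 1) * besselCoeff (ν + 1) m := by
  have h := natCast_add_add_one_ne_zero hν m
  rw [besselCoeff, besselCoeff, show (m : ℂ) + (ν + 1) + 1 = m + ν + 1 + 1 by ring,
    Complex.Gamma_add_one _ h, mul_div_assoc', mul_left_comm, mul_div_mul_left _ _ h]

lemma add_re_add_one_le_norm (ν : ℂ) (m : ℕ) : m + ν.re + 1 ≤ ‖(m : ℂ) + ν + 1‖ := by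
  simpa using Complex.re_le_norm ((m : ℂ) + ν + 1)

lemma summable_norm_besselCoeff_mul_pow {ν : ℂ} (hν : -1 < ν.re) {R : ℝ} (hR : 0 ≤ R) :
    Summable fun m ↦ ‖besselCoeff ν m‖ * R ^ m := by
  refine summable_of_ratio_norm_eventually_le (r := 1 / 2) (by norm_num) ?_
  filter_upwards [Filter.eventually_ge_atTop ⌈2 * R + 1⌉₊] with m hm
  have hm' : 2 * R + 1 ≤ m := (Nat.le_ceil _).trans (by exact_mod_cast hm)
  have h1 := add_re_add_one_le_norm ν m
  have h2 : ‖(m : ℂ) + 1‖ = m + 1 := by exact_mod_cast Complex.norm_natCast (m + 1)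
  have hpos : 0 < ‖(m : ℂ) + ν + 1‖ := by linarith
  rw [besselCoeff_succ hν]
  rw [norm_mul, norm_mul, norm_norm, norm_norm, norm_div, norm_mul, norm_neg, h2, norm_pow,
    norm_pow, Real.norm_of_nonneg hR]
  have key : R / ((m + 1) * ‖(m : ℂ) + ν + 1‖) ≤ 1 / 2 := by
    rw [div_le_div_iff₀ (by positivity) two_pos]
    nlinarith
  calc _ = R / ((m + 1) * ‖(m : ℂ) + ν + 1‖) * (‖besselCoeff ν m‖ * R ^ m) := by
        rw [pow_succ]; field_simp
    _ ≤ _ := by gcongr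

lemma summable_besselCoeff_mul_pow {ν : ℂ} (hν : -1 < ν.re) (w : ℝ) :
    Summable fun m ↦ besselCoeff ν m * (w : ℂ) ^ m :=
  .of_norm <| by
    simpa [norm_mul, norm_pow] using summable_norm_besselCoeff_mul_pow hν (abs_nonneg w)

lemma hasDerivAt_besselClifford {ν : ℂ} (hν : -1 < ν.re) (w : ℝ) :
    HasDerivAt (besselClifford ν) (-besselClifford (ν + 1) w) w := by
  have hν' : -1 < (ν + 1).re := by rw [Complex.add_re, Complex.one_re]; linarith
  set R := |w| + 1 with hR
  have hR0 : 0 ≤ R := by positivity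
  have hterm : ∀ m : ℕ, ((m + 1 : ℕ) : ℂ) * besselCoeff ν (m + 1) = -besselCoeff (ν + 1) m :=
    fun m ↦ by rw [← succ_mul_besselCoeff_succ]; push_cast; rfl
  have hu : Summable fun m : ℕ ↦ ‖(m : ℂ) * besselCoeff ν m‖ * R ^ (m - 1) := by
    rw [← summable_nat_add_iff 1]
    simpa only [hterm, norm_neg, add_tsub_cancel_right] using
      summable_norm_besselCoeff_mul_pow hν' hR0
  have hderiv := hasDerivAt_tsum_of_isPreconnected (𝕜 := ℝ) (t := Metric.ball (0 : ℝ) R)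
    (g := fun (m : ℕ) (z : ℝ) ↦ besselCoeff ν m * (z : ℂ) ^ m)
    (g' := fun (m : ℕ) (z : ℝ) ↦ besselCoeff ν m * (m * (z : ℂ) ^ (m - 1)))
    hu Metric.isOpen_ball (convex_ball _ _).isPreconnected
    (fun m z _ ↦ by
      simpa using ((hasDerivAt_pow m (z : ℂ)).comp_ofReal).const_mul (besselCoeff ν m))
    (fun m z hz ↦ by
      rw [mul_left_comm, ← mul_assoc, norm_mul, norm_pow, Complex.norm_real]
      have : ‖z‖ ≤ R := (mem_ball_zero_iff.1 hz).le
      gcongr)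
    (y₀ := w) (y := w) (by simp [hR]) (summable_besselCoeff_mul_pow hν w) (by simp [hR])
  refine hderiv.congr_deriv ?_
  have hs : Summable fun m : ℕ ↦ besselCoeff ν m * (m * (w : ℂ) ^ (m - 1)) := by
    rw [← summable_nat_add_iff 1]
    refine (summable_besselCoeff_mul_pow hν' w).neg.congr fun m ↦ ?_
    rw [mul_left_comm, ← mul_assoc, hterm, add_tsub_cancel_right, neg_mul]
  rw [hs.tsum_eq_zero_add, besselClifford, ← tsum_neg]
  simp only [CharP.cast_eq_zero, zero_mul, mul_zero, zero_add]
  refine tsum_congr fun m ↦ ?_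
  rw [mul_left_comm, ← mul_assoc, hterm, add_tsub_cancel_right, neg_mul]

lemma mul_besselClifford_add_two {ν : ℂ} (hν : -1 < ν.re) (w : ℝ) :
    w * besselClifford (ν + 1 + 1) w = (ν + 1) * besselClifford (ν + 1) w - besselClifford ν w := by
  have hν' : -1 < (ν + 1).re := by rw [Complex.add_re, Complex.one_re]; linarith
  have hs := summable_besselCoeff_mul_pow hν w
  have hs' := summable_besselCoeff_mul_pow hν' w
  have hd : ∀ m : ℕ, (ν + 1) * (besselCoeff (ν + 1) m * (w : ℂ) ^ m) - besselCoeff ν m * (w : ℂ) ^ m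
      = -(m * besselCoeff (ν + 1) m * (w : ℂ) ^ m) := fun m ↦ by
    rw [besselCoeff_eq_mul_besselCoeff_add_one hν m]; ring
  have hsub := (hs'.mul_left (ν + 1)).sub hs
  simp only [besselClifford]
  rw [← tsum_mul_left, ← tsum_mul_left, ← (hs'.mul_left (ν + 1)).tsum_sub hs,
    hsub.tsum_eq_zero_add, hd]
  simp only [CharP.cast_eq_zero, zero_mul, neg_zero, zero_add]
  refine tsum_congr fun m ↦ ?_
  rw [hd]
  push_cast
  rw [succ_mul_besselCoeff_succ, pow_succ]
  ring

lemma continuous_besselClifford {ν : ℂ} (hν : -1 < ν.re) : Continuous (besselClifford ν) :=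
  continuous_iff_continuousAt.2 fun w ↦ (hasDerivAt_besselClifford hν w).continuousAt

/-- Monotonicity of an energy of the Bessel differential equation. -/
lemma antitoneOn_besselClifford_energy {ν : ℂ} (hν : -1 < ν.re) :
    AntitoneOn (fun w : ℝ ↦ ‖besselClifford ν w‖ ^ 2 / w + ‖besselClifford (ν + 1) w‖ ^ 2)
      (Set.Ioi 0) := by
  have hν' : -1 < (ν + 1).re := by rw [Complex.add_re, Complex.one_re]; linarith
  have hderiv : ∀ w ∈ Set.Ioi (0 : ℝ),
      HasDerivAt (fun w : ℝ ↦ ‖besselClifford ν w‖ ^ 2 / w + ‖besselClifford (ν + 1) w‖ ^ 2)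
        (-(‖besselClifford ν w‖ ^ 2 + 2 * (ν.re + 1) * w * ‖besselClifford (ν + 1) w‖ ^ 2) / w ^ 2)
        w := by
    intro w (hw : 0 < w)
    have h0 := (hasDerivAt_besselClifford hν w).norm_sq
    have h1 := (hasDerivAt_besselClifford hν' w).norm_sq
    refine ((h0.div (hasDerivAt_id w) hw.ne').add h1).congr_deriv ?_
    have hrec := mul_besselClifford_add_two hν w
    set p := besselClifford ν w
    set q := besselClifford (ν + 1) w
    set r := besselClifford (ν + 1 + 1) w
    have hr := congrArg Complex.re hrec
    have hi := congrArg Complex.im hrec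
    simp only [Complex.inner, Complex.sq_norm, Complex.normSq_apply, Complex.mul_re, Complex.mul_im,
      Complex.conj_re, Complex.conj_im, Complex.neg_re, Complex.neg_im, Complex.add_re,
      Complex.add_im, Complex.sub_re, Complex.sub_im, Complex.ofReal_re, Complex.ofReal_im,
      Complex.one_re, Complex.one_im, id] at hr hi ⊢
    field_simp
    linear_combination (-2 * w * q.re) * hr - (2 * w * q.im) * hi
  refine antitoneOn_of_deriv_nonpos (convex_Ioi 0)
    (fun w hw ↦ (hderiv w hw).continuousAt.continuousWithinAt) ?_ ?_
  · rw [interior_Ioi]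
    exact fun w hw ↦ (hderiv w hw).differentiableAt.differentiableWithinAt
  · rw [interior_Ioi]
    intro w hw
    rw [(hderiv w hw).deriv, neg_div]
    have : 0 < ν.re + 1 := by linarith
    have : 0 < w := hw
    exact neg_nonpos.2 (by positivity)

lemma exists_norm_besselClifford_le {ν : ℂ} (hν : -1 < ν.re) :
    ∃ C : ℝ, ∀ w : ℝ, 0 ≤ w → ‖besselClifford ν w‖ ≤ C * (1 + w) := by
  obtain ⟨C₁, hC₁⟩ := isCompact_Icc.exists_bound_of_continuousOn
    (continuous_besselClifford hν).continuousOn (s := Set.Icc (0 : ℝ) 1)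
  set E : ℝ := ‖besselClifford ν 1‖ ^ 2 / 1 + ‖besselClifford (ν + 1) 1‖ ^ 2 with hE
  have hE0 : 0 ≤ E := by positivity
  have hC₁0 : 0 ≤ C₁ := (norm_nonneg _).trans (hC₁ 0 (by simp))
  refine ⟨C₁ + (1 + E), fun w hw ↦ ?_⟩
  rcases le_total w 1 with h | h
  · have := hC₁ w ⟨hw, h⟩
    nlinarith [mul_nonneg hC₁0 hw, mul_nonneg hE0 hw]
  · have hanti := antitoneOn_besselClifford_energy hν (Set.mem_Ioi.2 one_pos)
      (Set.mem_Ioi.2 (one_pos.trans_le h)) h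
    simp only [← hE] at hanti
    have h2 : ‖besselClifford ν w‖ ^ 2 / w ≤ E :=
      (le_add_of_nonneg_right (by positivity)).trans hanti
    rw [div_le_iff₀ (by linarith)] at h2
    have h3 : ‖besselClifford ν w‖ ≤ (1 + E) * (1 + w) := by
      refine abs_le_of_sq_le_sq' ?_ (by positivity) |>.2
      nlinarith [mul_nonneg hE0 hw, mul_nonneg hE0 hE0, mul_nonneg (mul_nonneg hE0 hE0) hw]
    nlinarith [mul_nonneg hC₁0 hw]

lemma besselJ_eq_mul_besselClifford (ν : ℂ) {x : ℝ} (hx : x ≠ 0) :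
    besselJ ν x = ((x : ℂ) / 2) ^ ν * besselClifford ν (x ^ 2 / 4) := by
  have hx' : (x : ℂ) / 2 ≠ 0 := div_ne_zero (by exact_mod_cast hx) two_ne_zero
  rw [besselJ, besselClifford, ← tsum_mul_left]
  refine tsum_congr fun m ↦ ?_
  have hpow : ((x : ℂ) / 2) ^ (2 * (m : ℂ)) = ((x : ℂ) ^ 2 / 4) ^ m := by
    rw [show 2 * (m : ℂ) = ((2 * m : ℕ) : ℂ) by push_cast; rfl, Complex.cpow_natCast, pow_mul,
      div_pow]
    norm_num
  rw [Complex.cpow_add _ _ hx', hpow, besselCoeff]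
  push_cast
  ring

/-- A Laplace transform is holomorphic on the right half-plane. -/
lemma differentiableOn_laplace {g : ℝ → ℂ}
    (hm : AEStronglyMeasurable g (volume.restrict (Set.Ioi 0)))
    (hg : ∀ ε : ℝ, 0 < ε → IntegrableOn (fun x ↦ Real.exp (-ε * x) * ‖g x‖) (Set.Ioi 0)) :
    DifferentiableOn ℂ (fun a : ℂ ↦ ∫ x in Set.Ioi (0 : ℝ), Complex.exp (-a * x) * g x)
      {a | 0 < a.re} := by
  intro a (ha : 0 < a.re)
  have hmeas : ∀ b : ℂ, AEStronglyMeasurable (fun x : ℝ ↦ Complex.exp (-b * x) * g x)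
      (volume.restrict (Set.Ioi 0)) := fun b ↦
    (Continuous.aestronglyMeasurable (by fun_prop)).mul hm
  have hnorm : ∀ (b : ℂ) (x : ℝ), ‖Complex.exp (-b * x)‖ = Real.exp (-b.re * x) := fun b x ↦ by
    simp [Complex.norm_exp]
  set δ := a.re / 4 with hδ
  have hδ0 : 0 < δ := by positivity
  have hs : {b : ℂ | 2 * δ < b.re} ∈ nhds a :=
    (isOpen_lt continuous_const Complex.continuous_re).mem_nhds
      (show 2 * δ < a.re by rw [hδ]; linarith)
  refine ((hasDerivAt_integral_of_dominated_loc_of_deriv_le (μ := volume.restrict (Set.Ioi 0))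
    (F := fun (b : ℂ) (x : ℝ) ↦ Complex.exp (-b * x) * g x)
    (F' := fun (b : ℂ) (x : ℝ) ↦ -x * (Complex.exp (-b * x) * g x))
    (bound := fun x ↦ δ⁻¹ * (Real.exp (-δ * x) * ‖g x‖)) hs (.of_forall hmeas)
    ?_ ?_ ?_ ((hg δ hδ0).const_mul _) ?_).2).differentiableAt.differentiableWithinAt
  · refine (hg a.re ha).mono' (hmeas a) (.of_forall fun x ↦ ?_)
    rw [norm_mul, hnorm]
  · exact (Continuous.aestronglyMeasurable (by fun_prop)).mul (hmeas a)
  · refine (ae_restrict_iff' measurableSet_Ioi).2 (.of_forall fun x (hx : 0 < x) b hb ↦ ?_)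
    rw [norm_mul, norm_mul, hnorm, norm_neg, Complex.norm_real, Real.norm_of_nonneg hx.le,
      ← mul_assoc, ← mul_assoc]
    refine mul_le_mul_of_nonneg_right ?_ (norm_nonneg _)
    have hb' : 2 * δ < b.re := hb
    have h1 : δ * x ≤ Real.exp (δ * x) := by linarith [Real.add_one_le_exp (δ * x)]
    have h2 : x ≤ δ⁻¹ * Real.exp (δ * x) := by
      rw [inv_mul_eq_div, le_div_iff₀ hδ0, mul_comm]; exact h1
    calc x * Real.exp (-b.re * x) ≤ (δ⁻¹ * Real.exp (δ * x)) * Real.exp (-(2 * δ) * x) := by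
          gcongr
      _ = δ⁻¹ * Real.exp (-δ * x) := by
          rw [mul_assoc, ← Real.exp_add]; ring_nf
  · refine .of_forall fun x b _ ↦ ?_
    have h : HasDerivAt (fun b : ℂ ↦ -b * (x : ℂ)) (-x) b := by
      simpa using (hasDerivAt_id b).neg.mul_const (x : ℂ)
    exact (h.cexp.mul_const (g x)).congr_deriv (by ring)

lemma integrableOn_rpow_mul_exp_neg_mul {σ ε : ℝ} (hσ : -1 < σ) (hε : 0 < ε) :
    IntegrableOn (fun x : ℝ ↦ x ^ σ * Real.exp (-ε * x)) (Set.Ioi 0) := by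
  simpa using integrableOn_rpow_mul_exp_neg_mul_rpow hσ one_pos hε

lemma aestronglyMeasurable_cpow_mul_besselClifford {ν : ℂ} (hν : -1 < ν.re) (y : ℝ) :
    AEStronglyMeasurable (fun x : ℝ ↦ (x : ℂ) ^ (2 * ν + 1) * besselClifford ν ((x * y) ^ 2 / 4))
      (volume.restrict (Set.Ioi 0)) := by
  refine ContinuousOn.aestronglyMeasurable (fun x hx ↦ ?_) measurableSet_Ioi
  refine ContinuousAt.continuousWithinAt (.mul ?_ ?_)
  · exact (continuousAt_cpow_const (Complex.ofReal_mem_slitPlane.2 hx)).comp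
      Complex.continuous_ofReal.continuousAt
  · exact ((continuous_besselClifford hν).comp (by fun_prop)).continuousAt

lemma integrableOn_exp_mul_norm_cpow_mul_besselClifford {ν : ℂ} (hν : -1 < ν.re) (y : ℝ) {ε : ℝ}
    (hε : 0 < ε) :
    IntegrableOn (fun x : ℝ ↦ Real.exp (-ε * x) *
      ‖(x : ℂ) ^ (2 * ν + 1) * besselClifford ν ((x * y) ^ 2 / 4)‖) (Set.Ioi 0) := by
  obtain ⟨C, hC⟩ := exists_norm_besselClifford_le hν
  have hσ : -1 < 2 * ν.re + 1 := by linarith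
  refine Integrable.mono' (((integrableOn_rpow_mul_exp_neg_mul hσ hε).const_mul C).add
    ((integrableOn_rpow_mul_exp_neg_mul (σ := 2 * ν.re + 1 + 2) (by linarith) hε).const_mul
      (C * (y ^ 2 / 4)))) ?_ ?_
  · exact (Continuous.aestronglyMeasurable (by fun_prop)).mul
      (aestronglyMeasurable_cpow_mul_besselClifford hν y).norm
  · refine (ae_restrict_iff' measurableSet_Ioi).2 (.of_forall fun x (hx : 0 < x) ↦ ?_)
    have hb := hC ((x * y) ^ 2 / 4) (by positivity)
    rw [norm_mul, norm_norm, Real.norm_of_nonneg (Real.exp_pos _).le, norm_mul,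
      Complex.norm_cpow_eq_rpow_re_of_pos hx]
    have hre : (2 * ν + 1).re = 2 * ν.re + 1 := by simp
    rw [hre]
    calc _ ≤ Real.exp (-ε * x) * (x ^ (2 * ν.re + 1) * (C * (1 + (x * y) ^ 2 / 4))) := by gcongr
      _ = _ := by
        simp only [Pi.add_apply]
        rw [Real.rpow_add hx _ 2, Real.rpow_two]
        ring

lemma choose_neg_mul_Gamma {r : ℂ} (hr : 0 < r.re) (m : ℕ) :
    Ring.choose (-r) m * Complex.Gamma r = (-1) ^ m * Complex.Gamma (r + m) / m.factorial := by
  induction m with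
  | zero => simp
  | succ m ih =>
    have hne : r + m ≠ 0 := by
      intro h
      have := congrArg Complex.re h
      simp only [Complex.add_re, Complex.natCast_re, Complex.zero_re] at this
      have : (0 : ℝ) ≤ m := m.cast_nonneg
      linarith
    have hstep : Ring.choose (-r) (m + 1) = Ring.choose (-r) m * (-r - m) / (m + 1) := by
      rw [Ring.choose_eq_smul, Ring.choose_eq_smul, descPochhammer_succ_right, Polynomial.smeval_mul,
        Nat.factorial_succ]
      simp only [Polynomial.smeval_sub, Polynomial.smeval_X, Polynomial.smeval_natCast, smul_eq_mul]
      push_cast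
      field_simp
      simp
    rw [hstep, div_mul_eq_mul_div, mul_right_comm, ih, Nat.cast_succ, ← add_assoc,
      Complex.Gamma_add_one _ hne, Nat.factorial_succ]
    push_cast
    field_simp
    ring

lemma besselCoeff_mul_Gamma {ν : ℂ} (hν : -1 < ν.re) (m : ℕ) :
    besselCoeff ν m * Complex.Gamma (2 * m + 2 * ν + 2) =
      2 ^ (2 * ν + 1) * Complex.Gamma (ν + 3 / 2) / √π * 4 ^ m *
        Ring.choose (-(ν + 3 / 2)) m := by
  have hΓ : Complex.Gamma (m + ν + 1) ≠ 0 := Complex.Gamma_ne_zero_of_re_pos <| by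
    have : (0 : ℝ) ≤ m := m.cast_nonneg
    simp only [Complex.add_re, Complex.natCast_re, Complex.one_re]
    linarith
  have hπ : ((√π : ℝ) : ℂ) ≠ 0 := by
    exact_mod_cast (Real.sqrt_pos.2 Real.pi_pos).ne'
  have hr : 0 < (ν + 3 / 2).re := by
    have : ((3 : ℂ) / 2).re = 3 / 2 := by norm_num
    rw [Complex.add_re, this]; linarith
  have hdup := Complex.Gamma_mul_Gamma_add_half (m + ν + 1)
  have hchoose := choose_neg_mul_Gamma hr m
  rw [show (m : ℂ) + ν + 1 + 1 / 2 = ν + 3 / 2 + m by ring,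
    show 2 * ((m : ℂ) + ν + 1) = 2 * m + 2 * ν + 2 by ring,
    show 1 - (2 * (m : ℂ) + 2 * ν + 2) = -((2 * ν + 1) + (2 * m : ℕ)) by push_cast; ring,
    Complex.cpow_neg, Complex.cpow_add _ _ two_ne_zero, Complex.cpow_natCast, pow_mul] at hdup
  norm_num only at hdup
  have h2 : (2 : ℂ) ^ (2 * ν + 1) ≠ 0 := by simp [Complex.cpow_eq_zero_iff]
  rw [besselCoeff]
  calc _ = (-1) ^ m / (m.factorial * Complex.Gamma (m + ν + 1)) * (2 ^ (2 * ν + 1) * 4 ^ m / √π *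
        (Complex.Gamma (2 * m + 2 * ν + 2) * (2 ^ (2 * ν + 1) * 4 ^ m)⁻¹ * √π)) := by
        field_simp
    _ = 2 ^ (2 * ν + 1) / √π * 4 ^ m *
        ((-1) ^ m * Complex.Gamma (ν + 3 / 2 + m) / m.factorial) := by
        rw [← hdup]; field_simp
    _ = _ := by rw [← hchoose]; ring

lemma summable_norm_besselCoeff_mul_Gamma {ν : ℂ} (hν : -1 < ν.re) {y a : ℝ} (ha : 0 < a)
    (hya : 2 * (1 + |ν.re + 1 / 2|) * y ^ 2 ≤ a ^ 2) :
    Summable fun m : ℕ ↦ ‖besselCoeff ν m‖ * (y ^ 2 / 4) ^ m *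
      ((1 / a) ^ (2 * m + 2 * ν.re + 2) * Real.Gamma (2 * m + 2 * ν.re + 2)) := by
  refine summable_of_ratio_norm_eventually_le (r := 1 / 2) (by norm_num) (.of_forall fun m ↦ ?_)
  have hm0 : (0 : ℝ) ≤ m := m.cast_nonneg
  set s : ℝ := 2 * m + 2 * ν.re + 2 with hs
  have hs0 : 0 < s := by rw [hs]; linarith
  have hcast : 2 * ((m + 1 : ℕ) : ℝ) + 2 * ν.re + 2 = s + 1 + 1 := by push_cast; ring
  have hG0 := Real.Gamma_pos_of_pos hs0
  have hG : Real.Gamma (s + 1 + 1) = (s + 1) * (s * Real.Gamma s) := by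
    rw [Real.Gamma_add_one (by positivity), Real.Gamma_add_one hs0.ne']
  have hpow : (1 / a) ^ (s + 1 + 1) = (1 / a) ^ s * (1 / a ^ 2) := by
    rw [Real.rpow_add_one (by positivity), Real.rpow_add_one (by positivity)]
    field_simp
  have h1 := add_re_add_one_le_norm ν m
  have h2 : ‖(m : ℂ) + 1‖ = m + 1 := by exact_mod_cast Complex.norm_natCast (m + 1)
  have hn : s / 2 ≤ ‖(m : ℂ) + ν + 1‖ := by rw [hs]; linarith
  have hn0 : 0 < ‖(m : ℂ) + ν + 1‖ := by linarith
  have key : (y ^ 2 / 4) * ((s + 1) * s) / ((m + 1) * ‖(m : ℂ) + ν + 1‖ * a ^ 2) ≤ 1 / 2 := by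
    have h3 : s + 1 ≤ 2 * (1 + |ν.re + 1 / 2|) * (m + 1) := by
      have := le_abs_self (ν.re + 1 / 2)
      have := mul_nonneg (abs_nonneg (ν.re + 1 / 2)) hm0
      rw [hs]; linarith
    rw [div_le_div_iff₀ (by positivity) two_pos]
    calc y ^ 2 / 4 * ((s + 1) * s) * 2
        ≤ y ^ 2 / 4 * ((2 * (1 + |ν.re + 1 / 2|) * (m + 1)) * (2 * ‖(m : ℂ) + ν + 1‖)) * 2 := by
          gcongr; linarith
      _ = (2 * (1 + |ν.re + 1 / 2|) * y ^ 2) * ((m + 1) * ‖(m : ℂ) + ν + 1‖) := by ring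
      _ ≤ a ^ 2 * ((m + 1) * ‖(m : ℂ) + ν + 1‖) := by gcongr
      _ = _ := by ring
  rw [hcast, Real.norm_of_nonneg (by positivity), Real.norm_of_nonneg (by positivity), hG, hpow,
    besselCoeff_succ hν, norm_div, norm_mul, norm_neg, h2, pow_succ]
  calc _ = (y ^ 2 / 4) * ((s + 1) * s) / ((m + 1) * ‖(m : ℂ) + ν + 1‖ * a ^ 2) *
        (‖besselCoeff ν m‖ * (y ^ 2 / 4) ^ m * ((1 / a) ^ s * Real.Gamma s)) := by
        field_simp
    _ ≤ _ := by gcongr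

lemma integral_exp_mul_cpow_mul_besselClifford {ν : ℂ} (hν : -1 < ν.re) {y a : ℝ} (hy : 0 < y)
    (ha : 0 < a) (hya : 2 * (1 + |ν.re + 1 / 2|) * y ^ 2 ≤ a ^ 2) :
    ∫ x in Set.Ioi (0 : ℝ), Complex.exp (-a * x) *
        ((x : ℂ) ^ (2 * ν + 1) * besselClifford ν ((x * y) ^ 2 / 4)) =
      2 ^ (2 * ν + 1) * Complex.Gamma (ν + 3 / 2) / √π * (1 / (a : ℂ)) ^ (2 * ν + 2) *
        (1 + (y : ℂ) ^ 2 / (a : ℂ) ^ 2) ^ (-(ν + 3 / 2)) := by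
  have ha' : (a : ℂ) ≠ 0 := by exact_mod_cast ha.ne'
  set F : ℕ → ℝ → ℂ := fun m x ↦ besselCoeff ν m * ((y : ℂ) ^ 2 / 4) ^ m *
    ((x : ℂ) ^ (2 * m + 2 * ν + 2 - 1) * Complex.exp (-(a * x))) with hF
  have hre : ∀ m : ℕ, (2 * m + 2 * ν + 2 : ℂ).re = 2 * m + 2 * ν.re + 2 := fun m ↦ by simp
  have hpos : ∀ m : ℕ, 0 < 2 * (m : ℝ) + 2 * ν.re + 2 := fun m ↦ by
    have : (0 : ℝ) ≤ m := m.cast_nonneg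
    linarith
  have hnorm : ∀ m : ℕ, ∀ x ∈ Set.Ioi (0 : ℝ), ‖F m x‖ = ‖besselCoeff ν m‖ * (y ^ 2 / 4) ^ m *
      (x ^ (2 * m + 2 * ν.re + 2 - 1) * Real.exp (-(a * x))) := fun m x hx ↦ by
    have h4 : ‖(y : ℂ) ^ 2 / 4‖ = y ^ 2 / 4 := by simp
    rw [hF]
    simp only [norm_mul, norm_pow, h4]
    rw [Complex.norm_cpow_eq_rpow_re_of_pos hx, Complex.sub_re, hre, Complex.norm_exp]
    simp
  have hmeas : ∀ m, AEStronglyMeasurable (F m) (volume.restrict (Set.Ioi 0)) := fun m ↦ by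
    refine ContinuousOn.aestronglyMeasurable (fun x hx ↦ ?_) measurableSet_Ioi
    refine ContinuousAt.continuousWithinAt (.mul continuousAt_const (.mul ?_ ?_))
    · exact (continuousAt_cpow_const (Complex.ofReal_mem_slitPlane.2 hx)).comp
        Complex.continuous_ofReal.continuousAt
    · exact Continuous.continuousAt (by fun_prop)
  have hint : ∀ m, Integrable (F m) (volume.restrict (Set.Ioi 0)) := fun m ↦ by
    rw [← integrable_norm_iff (hmeas m)]
    refine IntegrableOn.congr_fun ?_ (fun x hx ↦ (hnorm m x hx).symm) measurableSet_Ioi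
    have h := (integrableOn_rpow_mul_exp_neg_mul
      (σ := 2 * m + 2 * ν.re + 2 - 1) (by linarith [hpos m]) ha).const_mul
        (‖besselCoeff ν m‖ * (y ^ 2 / 4) ^ m)
    simpa only [neg_mul, IntegrableOn] using h
  have hsum : Summable fun m ↦ ∫ x in Set.Ioi (0 : ℝ), ‖F m x‖ := by
    refine (summable_norm_besselCoeff_mul_Gamma hν ha hya).congr fun m ↦ ?_
    rw [setIntegral_congr_fun measurableSet_Ioi (hnorm m), integral_const_mul,
      Real.integral_rpow_mul_exp_neg_mul_Ioi (hpos m) ha]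
  have hmain := hasSum_integral_of_summable_integral_norm hint hsum
  have hterm : ∀ m, ∫ x in Set.Ioi (0 : ℝ), F m x =
      2 ^ (2 * ν + 1) * Complex.Gamma (ν + 3 / 2) / √π * (1 / (a : ℂ)) ^ (2 * ν + 2) *
        (Ring.choose (-(ν + 3 / 2)) m * ((y : ℂ) ^ 2 / (a : ℂ) ^ 2) ^ m) := fun m ↦ by
    have hpow : (1 / (a : ℂ)) ^ (2 * (m : ℂ) + 2 * ν + 2) =
        (1 / (a : ℂ)) ^ (2 * ν + 2) * (1 / (a : ℂ) ^ 2) ^ m := by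
      rw [show 2 * (m : ℂ) + 2 * ν + 2 = 2 * ν + 2 + (2 * m : ℕ) by push_cast; ring,
        Complex.cpow_add _ _ (one_div_ne_zero ha'), Complex.cpow_natCast, pow_mul, div_pow, one_pow]
    rw [hF, integral_const_mul,
      Complex.integral_cpow_mul_exp_neg_mul_Ioi (by rw [hre]; exact hpos m) ha, hpow]
    calc _ = (besselCoeff ν m * Complex.Gamma (2 * m + 2 * ν + 2)) * (((y : ℂ) ^ 2 / 4) ^ m *
          (1 / (a : ℂ) ^ 2) ^ m * (1 / (a : ℂ)) ^ (2 * ν + 2)) := by ring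
      _ = _ := by
        rw [besselCoeff_mul_Gamma hν, div_pow, div_pow, div_pow, one_pow]
        field_simp
  simp only [hterm] at hmain
  have hlt : ‖(y : ℂ) ^ 2 / (a : ℂ) ^ 2‖ < 1 := by
    rw [norm_div, norm_pow, norm_pow, Complex.norm_real, Complex.norm_real,
      Real.norm_of_nonneg hy.le, Real.norm_of_nonneg ha.le, div_lt_one (by positivity)]
    nlinarith [mul_nonneg (abs_nonneg (ν.re + 1 / 2)) (sq_nonneg y), pow_pos hy 2]
  have hbin : HasSum (fun m ↦ Ring.choose (-(ν + 3 / 2)) m * ((y : ℂ) ^ 2 / (a : ℂ) ^ 2) ^ m)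
      ((1 + (y : ℂ) ^ 2 / (a : ℂ) ^ 2) ^ (-(ν + 3 / 2))) := by
    have := (Complex.one_add_cpow_hasFPowerSeriesOnBall_zero (a := -(ν + 3 / 2))).hasSum
      (y := (y : ℂ) ^ 2 / (a : ℂ) ^ 2) (by
        rw [Metric.mem_eball, edist_zero_right, ← ofReal_norm]
        exact ENNReal.ofReal_lt_one.2 hlt)
    simpa only [binomialSeries_apply, List.ofFn_const, List.prod_replicate, smul_eq_mul, zero_add]
      using this
  rw [(hbin.mul_left _).unique hmain]
  refine setIntegral_congr_fun measurableSet_Ioi fun x (hx : 0 < x) ↦ ?_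
  have hx' : (x : ℂ) ≠ 0 := by exact_mod_cast hx.ne'
  simp only [hF]
  rw [besselClifford, ← tsum_mul_left, ← tsum_mul_left]
  refine tsum_congr fun m ↦ ?_
  rw [show 2 * (m : ℂ) + 2 * ν + 2 - 1 = 2 * ν + 1 + (2 * m : ℕ) by push_cast; ring,
    Complex.cpow_add (2 * ν + 1) ((2 * m : ℕ) : ℂ) hx', Complex.cpow_natCast, pow_mul, neg_mul]
  push_cast
  rw [mul_pow, mul_div_assoc, mul_pow]
  ring

lemma sq_add_sq_mem_slitPlane {a : ℂ} (ha : 0 < a.re) (y : ℝ) :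
    a ^ 2 + (y : ℂ) ^ 2 ∈ Complex.slitPlane := by
  rw [Complex.mem_slitPlane_iff]
  by_cases h : a.im = 0
  · left
    simp only [sq, Complex.add_re, Complex.mul_re, Complex.ofReal_re, Complex.ofReal_im, h]
    nlinarith [mul_pos ha ha, mul_self_nonneg y]
  · right
    simp only [sq, Complex.add_im, Complex.mul_im, Complex.ofReal_re, Complex.ofReal_im]
    have := mul_ne_zero ha.ne' h
    intro h'
    apply this
    linarith

lemma besselJ_laplace_closed_form (ν : ℂ) {y a : ℝ} (hy : 0 < y) (ha : 0 < a) :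
    ((y : ℂ) / 2) ^ ν * (2 ^ (2 * ν + 1) * Complex.Gamma (ν + 3 / 2) / √π *
        (1 / (a : ℂ)) ^ (2 * ν + 2) * (1 + (y : ℂ) ^ 2 / (a : ℂ) ^ 2) ^ (-(ν + 3 / 2))) =
      (π : ℂ) ^ (-(1 / 2 : ℂ)) * 2 ^ (ν + 1) * Complex.Gamma (ν + 3 / 2) * a * (y : ℂ) ^ ν /
        ((a : ℂ) ^ 2 + (y : ℂ) ^ 2) ^ (ν + 3 / 2) := by
  have ha' : (a : ℂ) ≠ 0 := by exact_mod_cast ha.ne'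
  have hπ : (π : ℂ) ^ (-(1 / 2 : ℂ)) = 1 / √π := by
    rw [Complex.cpow_neg, Real.sqrt_eq_rpow, Complex.ofReal_cpow Real.pi_pos.le]
    push_cast
    rw [one_div, one_div]
  have hy2 : ((y : ℂ) / 2) ^ ν = (y : ℂ) ^ ν / 2 ^ ν := by
    have := Complex.mul_cpow_ofReal_nonneg (a := y / 2) (b := 2) (by positivity) zero_le_two ν
    rw [← Complex.ofReal_mul, div_mul_cancel₀ _ two_ne_zero] at this
    push_cast at this
    rw [this, mul_div_cancel_right₀]
    simp [Complex.cpow_eq_zero_iff]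
  have h2 : (2 : ℂ) ^ (2 * ν + 1) = 2 ^ ν * 2 ^ (ν + 1) := by
    rw [← Complex.cpow_add _ _ two_ne_zero]; ring_nf
  have h2ne : (2 : ℂ) ^ ν ≠ 0 := by simp [Complex.cpow_eq_zero_iff]
  have hane : (a : ℂ) ^ (2 * ν + 2) ≠ 0 := by simp [Complex.cpow_eq_zero_iff, ha']
  have hainv : (1 / (a : ℂ)) ^ (2 * ν + 2) = ((a : ℂ) ^ (2 * ν + 2))⁻¹ := by
    rw [one_div, Complex.inv_cpow _ _ (by rw [Complex.arg_ofReal_of_nonneg ha.le]; exact pi_pos.ne)]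
  have hsplit : ((a : ℂ) ^ 2 + (y : ℂ) ^ 2) ^ (ν + 3 / 2) =
      (a : ℂ) ^ (2 * ν + 2) * a * (1 + (y : ℂ) ^ 2 / (a : ℂ) ^ 2) ^ (ν + 3 / 2) := by
    have h := Complex.mul_cpow_ofReal_nonneg (a := a ^ 2) (b := 1 + y ^ 2 / a ^ 2)
      (by positivity) (by positivity) (ν + 3 / 2)
    have hsq : ((a : ℂ) ^ 2) ^ (ν + 3 / 2) = (a : ℂ) ^ (2 * ν + 2) * a := by
      have h := Complex.mul_cpow_ofReal_nonneg ha.le ha.le (ν + 3 / 2)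
      rw [sq, h, ← Complex.cpow_add _ _ ha']
      nth_rewrite 3 [← Complex.cpow_one (a : ℂ)]
      rw [← Complex.cpow_add _ _ ha']
      ring_nf
    push_cast at h
    rw [hsq, mul_add, mul_one, mul_div_cancel₀ _ (pow_ne_zero 2 ha')] at h
    exact h
  rw [hπ, hy2, h2, hainv, hsplit, Complex.cpow_neg]
  field_simp

theorem laplace_transform_besselJ (a ν : ℂ) (ha : 0 < a.re) (hν : -1 < ν.re)
    (y : ℝ) (hy : 0 < y) :
    ∫ x in Set.Ioi (0:ℝ), (x:ℂ) ^ (ν + 1) * Complex.exp (-a * x) * besselJ ν (x * y) =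
      (Real.pi : ℂ) ^ (-(1/2 : ℂ)) * 2 ^ (ν + 1) * Complex.Gamma (ν + 3/2) * a * (y:ℂ) ^ ν /
        (a^2 + (y:ℂ)^2) ^ (ν + 3/2) := by
  set L : ℂ → ℂ := fun a ↦ ∫ x in Set.Ioi (0 : ℝ), Complex.exp (-a * x) *
    ((x : ℂ) ^ (2 * ν + 1) * besselClifford ν ((x * y) ^ 2 / 4)) with hL
  set R : ℂ → ℂ := fun a ↦ (Real.pi : ℂ) ^ (-(1 / 2 : ℂ)) * 2 ^ (ν + 1) *
    Complex.Gamma (ν + 3 / 2) * a * (y : ℂ) ^ ν / (a ^ 2 + (y : ℂ) ^ 2) ^ (ν + 3 / 2) with hR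
  have hopen : IsOpen {b : ℂ | 0 < b.re} := isOpen_lt continuous_const Complex.continuous_re
  have hLd : DifferentiableOn ℂ (fun b ↦ ((y : ℂ) / 2) ^ ν * L b) {b | 0 < b.re} :=
    (differentiableOn_laplace (aestronglyMeasurable_cpow_mul_besselClifford hν y)
      fun ε hε ↦ integrableOn_exp_mul_norm_cpow_mul_besselClifford hν y hε).const_mul _
  have hRd : DifferentiableOn ℂ R {b | 0 < b.re} := by
    intro b (hb : 0 < b.re)
    have hslit := sq_add_sq_mem_slitPlane hb y
    have hne : (b ^ 2 + (y : ℂ) ^ 2) ^ (ν + 3 / 2) ≠ 0 := by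
      simp [Complex.cpow_eq_zero_iff, Complex.slitPlane_ne_zero hslit]
    refine DifferentiableAt.differentiableWithinAt (.div (by fun_prop) ?_ hne)
    exact DifferentiableAt.cpow_const (by fun_prop) hslit
  have hreal : ∀ b : ℝ, 0 < b → 2 * (1 + |ν.re + 1 / 2|) * y ^ 2 ≤ b ^ 2 →
      ((y : ℂ) / 2) ^ ν * L b = R b := fun b hb hyb ↦ by
    simp only [hL, hR]
    rw [integral_exp_mul_cpow_mul_besselClifford hν hy hb hyb, besselJ_laplace_closed_form ν hy hb]
  set A : ℝ := 2 * (1 + |ν.re + 1 / 2|) * y ^ 2 + 1 with hA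
  have hA1 : 1 ≤ A := by rw [hA]; linarith [show 0 ≤ 2 * (1 + |ν.re + 1 / 2|) * y ^ 2 by positivity]
  have hfreq : ∃ᶠ z in nhdsWithin (A : ℂ) {(A : ℂ)}ᶜ, ((y : ℂ) / 2) ^ ν * L z = R z := by
    have htend : Filter.Tendsto (fun t : ℝ ↦ (t : ℂ)) (nhdsWithin A (Set.Ioi A))
        (nhdsWithin (A : ℂ) {(A : ℂ)}ᶜ) := by
      refine tendsto_nhdsWithin_iff.2
        ⟨Complex.continuous_ofReal.continuousAt.tendsto.mono_left nhdsWithin_le_nhds, ?_⟩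
      filter_upwards [self_mem_nhdsWithin] with t ht
      exact fun h ↦ (ne_of_gt ht) (Complex.ofReal_injective h)
    refine htend.frequently (Filter.Eventually.frequently ?_)
    filter_upwards [self_mem_nhdsWithin] with t (ht : A < t)
    exact hreal t (by linarith) (by nlinarith)
  have heq := AnalyticOnNhd.eqOn_of_preconnected_of_frequently_eq (hLd.analyticOnNhd hopen)
    (hRd.analyticOnNhd hopen) (convex_halfSpace_re_gt 0).isPreconnected
    (show (A : ℂ) ∈ {b : ℂ | 0 < b.re} by simp; linarith) hfreq
  refine Eq.trans ?_ (show ((y : ℂ) / 2) ^ ν * L a = R a from heq ha)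
  rw [hL, ← integral_const_mul]
  refine setIntegral_congr_fun measurableSet_Ioi fun x (hx : 0 < x) ↦ ?_
  have hx' : (x : ℂ) ≠ 0 := by exact_mod_cast hx.ne'
  have hmul := Complex.mul_cpow_ofReal_nonneg hx.le (show 0 ≤ y / 2 by positivity) ν
  push_cast at hmul
  have hxν : (x : ℂ) ^ (2 * ν + 1) = (x : ℂ) ^ (ν + 1) * (x : ℂ) ^ ν := by
    rw [← Complex.cpow_add _ _ hx']; ring_nf
  rw [besselJ_eq_mul_besselClifford ν (mul_pos hx hy).ne', hxν]
  push_cast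
  rw [mul_div_assoc, hmul]
  ring
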